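/- arXiv:1010.4642 — 6 statements merged into one kernel-verified Lean document; each statement's English description precedes it below -/
import Mathlib

section
/- Let Γ = {x_1,…,x_n} ⊂ ℝ^d be a finite grid, p ∈ [1,∞), and ξ ∈ conv(Γ). Then the p-th power of the local dual quantization error admits the dual representation F^p(ξ;Γ) = max_{u ∈ ℝ^d} min_{1≤i≤n} { ‖ξ − x_i‖^p + u^T(ξ − x_i) }. -/
open MeasureTheory Set
open scoped ENNReal

/-- `p`-th power of the local dual quantization error `F_p(ξ; Γ)^p` for the grid given by the
tuple `x = (x_1, …, x_n)`, with the convention `inf ∅ = +∞`. -/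
noncomputable def dualQuantFp {E : Type*} [NormedAddCommGroup E] [NormedSpace ℝ E]
    (p : ℝ) {n : ℕ} (x : Fin n → E) (ξ : E) : ℝ≥0∞ :=
  ⨅ l : {l : Fin n → ℝ // (∀ i, 0 ≤ l i) ∧ ∑ i, l i = 1 ∧ ∑ i, l i • x i = ξ},
    ENNReal.ofReal (∑ i, l.1 i * ‖ξ - x i‖ ^ p)

/-- **Farkas' lemma** for finitely many linear functionals on a vector space of arbitrary
dimension. -/
theorem exists_nonneg_sum_smul_eq_of_forall_nonpos {V : Type*} [AddCommGroup V] [Module ℝ V]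
    {n : ℕ} (a : Fin n → V →ₗ[ℝ] ℝ) (γ : V →ₗ[ℝ] ℝ)
    (h : ∀ v, (∀ i, a i v ≤ 0) → γ v ≤ 0) :
    ∃ l : Fin n → ℝ, (∀ i, 0 ≤ l i) ∧ ∑ i, l i • a i = γ := by
  induction n generalizing γ with
  | zero =>
    refine ⟨0, by simp, ?_⟩
    ext v
    have h₁ := h v (fun i => i.elim0)
    have h₂ := h (-v) (fun i => i.elim0)
    rw [map_neg] at h₂
    simp only [Finset.univ_eq_empty, Finset.sum_empty, LinearMap.zero_apply]
    linarith
  | succ n ih =>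
    by_cases h' : ∀ v, (∀ i : Fin n, a i.succ v ≤ 0) → γ v ≤ 0
    · obtain ⟨l, hl, hlγ⟩ := ih (fun i => a i.succ) γ h'
      refine ⟨Fin.cons 0 l, Fin.cases (by simp) (by simpa using hl), ?_⟩
      simpa [Fin.sum_univ_succ] using hlγ
    · push Not at h'
      obtain ⟨w, hw, hγw⟩ := h'
      have hw₀ : 0 < a 0 w := by
        by_contra! hc
        exact hγw.not_ge (h w (Fin.cases hc hw))
      set z := (a 0 w)⁻¹ • w with hz
      have hz₀ : a 0 z = 1 := by simp [hz, hw₀.ne']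
      have hza : ∀ i : Fin n, a i.succ z ≤ 0 := fun i => by
        simpa [hz] using mul_nonpos_of_nonneg_of_nonpos (inv_pos.2 hw₀).le (hw i)
      have hzγ : 0 ≤ γ z := by
        simpa [hz] using mul_nonneg (inv_pos.2 hw₀).le hγw.le
      obtain ⟨l, hl, hlγ⟩ := ih (fun i => a i.succ - a i.succ z • a 0) (γ - γ z • a 0)
        (fun v hv => by
          have key := h (v - a 0 v • z) (Fin.cases (by simp [hz₀]) fun i => by
            have := hv i
            simp only [LinearMap.sub_apply, LinearMap.smul_apply, smul_eq_mul] at this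
            simp only [map_sub, map_smul, smul_eq_mul]
            linarith)
          simp only [map_sub, map_smul, smul_eq_mul] at key
          simp only [LinearMap.sub_apply, LinearMap.smul_apply, smul_eq_mul]
          linarith)
      have hsum : ∑ i, l i * a i.succ z ≤ 0 :=
        Finset.sum_nonpos fun i _ => mul_nonpos_of_nonneg_of_nonpos (hl i) (hza i)
      have hcoeff : 0 ≤ γ z - ∑ i, l i * a i.succ z := by linarith
      refine ⟨Fin.cons (γ z - ∑ i, l i * a i.succ z) l,
        Fin.cases (by simpa using hcoeff) (by simpa using hl), ?_⟩
      ext v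
      have hv := LinearMap.congr_fun hlγ v
      simp only [LinearMap.sum_apply, LinearMap.sub_apply, LinearMap.smul_apply, smul_eq_mul,
        mul_sub, Finset.sum_sub_distrib, ← mul_assoc, ← Finset.sum_mul] at hv
      simp only [Fin.sum_univ_succ, Fin.cons_zero, Fin.cons_succ, LinearMap.add_apply,
        LinearMap.sum_apply, LinearMap.smul_apply, smul_eq_mul, sub_mul]
      linarith

/-- If `m` is a lower bound of `∑ l i * c i` over all convex weights `l` with `∑ l i • y i = 0`,
then some continuous linear form `u` satisfies `m ≤ c i + u (y i)` for all `i`. -/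
theorem exists_forall_le_add_of_forall_le_sum {E : Type*} [NormedAddCommGroup E]
    [NormedSpace ℝ E] {n : ℕ} (y : Fin n → E) (c : Fin n → ℝ) (m : ℝ)
    (hm : ∀ l : Fin n → ℝ, (∀ i, 0 ≤ l i) → ∑ i, l i = 1 → ∑ i, l i • y i = 0 →
      m ≤ ∑ i, l i * c i) :
    ∃ u : E →L[ℝ] ℝ, ∀ i, m ≤ c i + u (y i) := by
  let ev : E → (E →L[ℝ] ℝ) →ₗ[ℝ] ℝ := fun z =>
    (ContinuousLinearMap.apply ℝ ℝ z : (E →L[ℝ] ℝ) →L[ℝ] ℝ)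
  let a : Fin n → ((E →L[ℝ] ℝ) × ℝ) →ₗ[ℝ] ℝ := fun i =>
    -(ev (y i) ∘ₗ LinearMap.fst ℝ _ _ + (c i - m) • LinearMap.snd ℝ _ _)
  have ha : ∀ i u t, a i (u, t) = -(u (y i) + (c i - m) * t) := fun i u t => by simp [a, ev]
  by_cases h : ∀ v, (∀ i, a i v ≤ 0) → LinearMap.snd ℝ (E →L[ℝ] ℝ) ℝ v ≤ 0
  · obtain ⟨l, hl, hsum⟩ := exists_nonneg_sum_smul_eq_of_forall_nonpos a _ h
    have hy : ∑ i, l i • y i = 0 := by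
      refine SeparatingDual.eq_zero_of_forall_dual_eq_zero (R := ℝ) fun u => ?_
      have := LinearMap.congr_fun hsum (u, 0)
      simpa [LinearMap.sum_apply, ha] using this
    have hc : ∑ i, l i * (c i - m) = -1 := by
      have := LinearMap.congr_fun hsum (0, 1)
      simp only [LinearMap.sum_apply, LinearMap.smul_apply, ha, smul_eq_mul,
        zero_apply, zero_add, mul_one, mul_neg, Finset.sum_neg_distrib,
        LinearMap.snd_apply] at this
      linarith
    have hs₀ : 0 ≤ ∑ i, l i := Finset.sum_nonneg fun i _ => hl i
    have hs : 0 < ∑ i, l i := by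
      refine hs₀.lt_of_ne' fun h₀ => ?_
      rw [Finset.sum_eq_zero_iff_of_nonneg fun i _ => hl i] at h₀
      rw [Finset.sum_eq_zero fun i hi => by rw [h₀ i hi, zero_mul]] at hc
      norm_num at hc
    have := hm (fun i => (∑ j, l j)⁻¹ * l i) (fun i => mul_nonneg (inv_nonneg.2 hs₀) (hl i))
      (by rw [← Finset.mul_sum, inv_mul_cancel₀ hs.ne'])
      (by simp_rw [mul_smul]; rw [← Finset.smul_sum, hy, smul_zero])
    simp_rw [mul_assoc] at this
    rw [← Finset.mul_sum, inv_mul_eq_div, le_div_iff₀ hs] at this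
    simp_rw [mul_sub] at hc
    rw [Finset.sum_sub_distrib, ← Finset.sum_mul] at hc
    linarith
  · push Not at h
    obtain ⟨⟨u, t⟩, hut, ht⟩ := h
    replace ht : 0 < t := ht
    refine ⟨t⁻¹ • u, fun i => ?_⟩
    have := hut i
    rw [ha] at this
    have key : t⁻¹ * (u (y i) + (c i - m) * t) = u (y i) * t⁻¹ + (c i - m) := by
      field_simp
    have : 0 ≤ t⁻¹ * (u (y i) + (c i - m) * t) := mul_nonneg (inv_pos.2 ht).le (by linarith)
    rw [smul_apply, smul_eq_mul]
    linarith

/-- The convex hull of the range of a finite family consists of its convex combinations. -/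
theorem exists_weights_of_mem_convexHull_range {E : Type*} [AddCommGroup E] [Module ℝ E]
    {n : ℕ} {x : Fin n → E} {ξ : E} (hξ : ξ ∈ convexHull ℝ (Set.range x)) :
    ∃ l : Fin n → ℝ, (∀ i, 0 ≤ l i) ∧ ∑ i, l i = 1 ∧ ∑ i, l i • x i = ξ := by
  rw [convexHull_range_eq_exists_affineCombination] at hξ
  obtain ⟨s, w, hw₀, hw₁, rfl⟩ := hξ
  refine ⟨fun i => if i ∈ s then w i else 0, fun i => ?_, by simpa using hw₁, ?_⟩
  · dsimp only
    split_ifs with hi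
    exacts [hw₀ i hi, le_rfl]
  · rw [s.affineCombination_eq_linear_combination _ _ hw₁]
    simp [ite_smul]

/-- **duality.** For a grid `Γ = {x_1,…,x_n} ⊂ ℝ^d`, `p ∈ [1,∞)` and
`ξ ∈ conv(Γ)`, one has
`F^p(ξ;Γ) = max_{u} min_{1≤i≤n} { ‖ξ − x_i‖^p + u(ξ − x_i) }`,
the maximum running over all linear forms `u` on `ℝ^d` (i.e. over `u ∈ ℝ^d`, acting by the
canonical inner product), and it is attained. -/
theorem stmt3 {E : Type*} [NormedAddCommGroup E] [NormedSpace ℝ E]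
    [FiniteDimensional ℝ E]
    (p : ℝ) (hp : 1 ≤ p) {n : ℕ} (x : Fin n → E) (ξ : E)
    (hξ : ξ ∈ convexHull ℝ (Set.range x)) :
    IsGreatest {v : ℝ | ∃ u : E →L[ℝ] ℝ, v = ⨅ i, (‖ξ - x i‖ ^ p + u (ξ - x i))}
      ((dualQuantFp p x ξ).toReal) := by
  obtain ⟨l₀, hl₀, hl₀₁, hl₀ξ⟩ := exists_weights_of_mem_convexHull_range hξ
  have hfin : dualQuantFp p x ξ ≠ ⊤ :=
    ne_top_of_le_ne_top ENNReal.ofReal_ne_top (iInf_le _ ⟨l₀, hl₀, hl₀₁, hl₀ξ⟩)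
  have : Nonempty (Fin n) := by
    by_contra hn
    rw [not_nonempty_iff] at hn
    simp at hl₀₁
  have weak (u : E →L[ℝ] ℝ) :
      ⨅ i, (‖ξ - x i‖ ^ p + u (ξ - x i)) ≤ (dualQuantFp p x ξ).toReal := by
    rw [← ENNReal.ofReal_le_iff_le_toReal hfin]
    refine le_iInf fun ⟨l, hl, hl₁, hlξ⟩ => ENNReal.ofReal_le_ofReal ?_
    have hu : ∑ i, l i * u (ξ - x i) = 0 := by
      have : u (∑ i, l i • (ξ - x i)) = 0 := by
        simp_rw [smul_sub]
        rw [Finset.sum_sub_distrib, ← Finset.sum_smul, hl₁, hlξ, one_smul, sub_self, map_zero]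
      simpa only [map_sum, map_smul, smul_eq_mul] using this
    calc ⨅ i, (‖ξ - x i‖ ^ p + u (ξ - x i))
        = ∑ j, l j * ⨅ i, (‖ξ - x i‖ ^ p + u (ξ - x i)) := by
          rw [← Finset.sum_mul, hl₁, one_mul]
      _ ≤ ∑ j, l j * (‖ξ - x j‖ ^ p + u (ξ - x j)) :=
          Finset.sum_le_sum fun j _ =>
            mul_le_mul_of_nonneg_left (ciInf_le (Set.finite_range _).bddBelow j) (hl j)
      _ = ∑ j, l j * ‖ξ - x j‖ ^ p := by
          simp_rw [mul_add]
          rw [Finset.sum_add_distrib, hu, add_zero]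
  refine ⟨?_, ?_⟩
  · obtain ⟨u, hu⟩ := exists_forall_le_add_of_forall_le_sum (fun i => ξ - x i)
      (fun i => ‖ξ - x i‖ ^ p) (dualQuantFp p x ξ).toReal fun l hl hl₁ hly => by
        refine ENNReal.toReal_le_of_le_ofReal
          (Finset.sum_nonneg fun i _ => mul_nonneg (hl i) (by positivity))
          (iInf_le _ (⟨l, hl, hl₁, ?_⟩ : {l : Fin n → ℝ // _}))
        simp_rw [smul_sub] at hly
        rw [Finset.sum_sub_distrib, ← Finset.sum_smul, hl₁, one_smul] at hly
        exact (sub_eq_zero.1 hly).symm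
    exact ⟨u, le_antisymm (le_ciInf hu) (weak u)⟩
  · rintro _ ⟨u, rfl⟩
    exact weak u
end

section
/- Let Γ = {x_1,…,x_n} ⊂ ℝ^d be a fixed finite grid and p ∈ [1,∞). Then the function f_Γ : conv(Γ) → ℝ defined by f_Γ(ξ) = F^p(ξ;Γ) is continuous on conv(Γ). -/
open MeasureTheory Set
open scoped ENNReal

open Filter Topology

section

variable {E : Type*} [NormedAddCommGroup E] [NormedSpace ℝ E] {n : ℕ}

lemma convexHull_range_eq_image_stdSimplex (x : Fin n → E) :
    convexHull ℝ (range x) = (fun l : Fin n → ℝ => ∑ i, l i • x i) '' stdSimplex ℝ (Fin n) := by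
  have h := (Fintype.linearCombination ℝ x).image_convexHull
    (range fun i j : Fin n => if i = j then (1 : ℝ) else 0)
  rw [convexHull_basis_eq_stdSimplex, ← range_comp] at h
  have hx : (Fintype.linearCombination ℝ x : (Fin n → ℝ) → E) ∘
      (fun i j : Fin n => if i = j then (1 : ℝ) else 0) = x := by
    ext i
    simp [Fintype.linearCombination_apply]
  rw [hx] at h
  rw [← h]
  rfl

lemma continuous_sum_smul_const (x : Fin n → E) :
    Continuous fun l : Fin n → ℝ => ∑ i, l i • x i := by
  fun_prop

/-- The barycentric parametrization of a polytope by the standard simplex is open onto its image,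
phrased along sequences. -/
lemma exists_seq_stdSimplex_tendsto (x : Fin n → E) {l₀ : Fin n → ℝ}
    (hl₀ : l₀ ∈ stdSimplex ℝ (Fin n)) {u : ℕ → E}
    (hu : ∀ k, u k ∈ convexHull ℝ (range x))
    (hlim : Tendsto u atTop (𝓝 (∑ i, l₀ i • x i))) :
    ∃ (l : ℕ → Fin n → ℝ) (φ : ℕ → ℕ), StrictMono φ ∧ (∀ k, l k ∈ stdSimplex ℝ (Fin n)) ∧
      (∀ k, ∑ i, l k i • x i = u (φ k)) ∧ Tendsto l atTop (𝓝 l₀) := by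
  have hmin : ∀ k, ∃ l ∈ stdSimplex ℝ (Fin n), ∑ i, l i • x i = u k ∧
      ∀ m ∈ stdSimplex ℝ (Fin n), ∑ i, m i • x i = u k → dist l l₀ ≤ dist m l₀ := by
    intro k
    have hk := hu k
    rw [convexHull_range_eq_image_stdSimplex] at hk
    obtain ⟨l, hl, hlu⟩ := hk
    have hcomp : IsCompact (stdSimplex ℝ (Fin n) ∩ {l | ∑ i, l i • x i = u k}) :=
      (isCompact_stdSimplex ℝ (Fin n)).inter_right
        (isClosed_eq (continuous_sum_smul_const x) continuous_const)
    obtain ⟨m, hm, hmin⟩ := hcomp.exists_isMinOn ⟨l, hl, hlu⟩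
      (f := fun l => dist l l₀) (by fun_prop)
    exact ⟨m, hm.1, hm.2, fun m' h h' => hmin ⟨h, h'⟩⟩
  choose l hl hlu hmin using hmin
  obtain ⟨μ, hμ, φ, hφ, hφμ⟩ := (isCompact_stdSimplex ℝ (Fin n)).tendsto_subseq hl
  have hTμ : ∑ i, μ i • x i = ∑ i, l₀ i • x i := by
    refine tendsto_nhds_unique
      (((continuous_sum_smul_const x).tendsto μ).comp hφμ) ?_
    refine (hlim.comp hφ.tendsto_atTop).congr fun k => ?_
    simp [hlu]
  suffices h : μ = l₀ from
    ⟨l ∘ φ, φ, hφ, fun k => hl _, fun k => hlu _, h ▸ hφμ⟩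
  by_contra hne
  have hpos : 0 < dist μ l₀ := dist_pos.2 hne
  have hd₁ : Tendsto (fun k => dist (l (φ k)) l₀) atTop (𝓝 (dist μ l₀)) :=
    hφμ.dist tendsto_const_nhds
  have hd₂ : Tendsto (fun k => dist (l (φ k) + (1 / 2 : ℝ) • (l₀ - μ)) l₀) atTop
      (𝓝 (dist μ l₀ / 2)) := by
    have : dist (μ + (1 / 2 : ℝ) • (l₀ - μ)) l₀ = dist μ l₀ / 2 := by
      rw [dist_eq_norm, dist_eq_norm,
        show μ + (1 / 2 : ℝ) • (l₀ - μ) - l₀ = (1 / 2 : ℝ) • (μ - l₀) by module, norm_smul]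
      norm_num
      ring
    rw [← this]
    exact (hφμ.add_const _).dist tendsto_const_nhds
  have hlt := hd₂.eventually_lt hd₁ (half_lt_self hpos)
  have hnonneg : ∀ᶠ k in atTop, ∀ i, 0 ≤ (l (φ k) + (1 / 2 : ℝ) • (l₀ - μ)) i := by
    refine eventually_all.2 fun i => ?_
    have h₀ := hl₀.1 i
    rcases (hμ.1 i).eq_or_lt with hi | hi
    · refine Eventually.of_forall fun k => ?_
      have := (hl (φ k)).1 i
      simp only [Pi.add_apply, Pi.smul_apply, Pi.sub_apply, smul_eq_mul]
      linarith
    · filter_upwards [(tendsto_pi_nhds.1 hφμ i).eventually_const_lt (half_lt_self hi)] with k hk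
      simp only [Function.comp_apply] at hk
      simp only [Pi.add_apply, Pi.smul_apply, Pi.sub_apply, smul_eq_mul]
      linarith
  obtain ⟨k, hk, hk'⟩ := (hlt.and hnonneg).exists
  refine hk.not_ge (hmin (φ k) _ ⟨hk', ?_⟩ ?_)
  · simp [Finset.sum_add_distrib, ← Finset.mul_sum, (hl (φ k)).2, hl₀.2, hμ.2]
  · simp only [Pi.add_apply, Pi.smul_apply, Pi.sub_apply, add_smul, smul_assoc, sub_smul,
      Finset.sum_add_distrib, ← Finset.smul_sum, Finset.sum_sub_distrib, hTμ, hlu]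
    simp

lemma dualQuantFp_toReal_le (p : ℝ) (x : Fin n → E) {l : Fin n → ℝ}
    (hl : l ∈ stdSimplex ℝ (Fin n)) {ξ : E} (hξ : ∑ i, l i • x i = ξ) :
    (dualQuantFp p x ξ).toReal ≤ ∑ i, l i * ‖ξ - x i‖ ^ p := by
  refine ENNReal.toReal_le_of_le_ofReal
    (Finset.sum_nonneg fun i _ => mul_nonneg (hl.1 i) (by positivity)) ?_
  exact iInf_le_of_le ⟨l, hl.1, hl.2, hξ⟩ le_rfl

lemma exists_dualQuantFp_toReal_eq (p : ℝ) (x : Fin n → E) {ξ : E}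
    (hξ : ξ ∈ convexHull ℝ (range x)) :
    ∃ l ∈ stdSimplex ℝ (Fin n), ∑ i, l i • x i = ξ ∧
      (dualQuantFp p x ξ).toReal = ∑ i, l i * ‖ξ - x i‖ ^ p := by
  rw [convexHull_range_eq_image_stdSimplex] at hξ
  obtain ⟨l, hl, hlξ⟩ := hξ
  have hcomp : IsCompact (stdSimplex ℝ (Fin n) ∩ {l | ∑ i, l i • x i = ξ}) :=
    (isCompact_stdSimplex ℝ (Fin n)).inter_right
      (isClosed_eq (continuous_sum_smul_const x) continuous_const)
  obtain ⟨m, hm, hmin⟩ := hcomp.exists_isMinOn ⟨l, hl, hlξ⟩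
    (f := fun l : Fin n → ℝ => ∑ i, l i * ‖ξ - x i‖ ^ p) (by fun_prop)
  refine ⟨m, hm.1, hm.2, ?_⟩
  have : dualQuantFp p x ξ = ENNReal.ofReal (∑ i, m i * ‖ξ - x i‖ ^ p) :=
    le_antisymm (iInf_le_of_le ⟨m, hm.1.1, hm.1.2, hm.2⟩ le_rfl)
      (le_iInf fun l => ENNReal.ofReal_le_ofReal (hmin ⟨⟨l.2.1, l.2.2.1⟩, l.2.2.2⟩))
  rw [this, ENNReal.toReal_ofReal]
  exact Finset.sum_nonneg fun i _ => mul_nonneg (hm.1.1 i) (by positivity)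

end

lemma tendsto_sum_mul_norm_sub_rpow {E : Type*} [NormedAddCommGroup E] {n : ℕ} {p : ℝ}
    (hp : 0 ≤ p) (x : Fin n → E) {l : ℕ → Fin n → ℝ} {l₀ : Fin n → ℝ} {u : ℕ → E} {ξ : E}
    (hl : Tendsto l atTop (𝓝 l₀))
    (hu : Tendsto u atTop (𝓝 ξ)) :
    Tendsto (fun k => ∑ i, l k i * ‖u k - x i‖ ^ p) atTop (𝓝 (∑ i, l₀ i * ‖ξ - x i‖ ^ p)) :=
  tendsto_finsetSum _ fun i _ =>
    (tendsto_pi_nhds.1 hl i).mul ((hu.sub_const (x i)).norm.rpow_const (Or.inr hp))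

/-- For a fixed finite grid `Γ = {x_1,…,x_n} ⊂ ℝ^d` and `p ∈ [1,∞)`,
the function `f_Γ(ξ) = F^p(ξ;Γ)` is continuous on `conv(Γ)`. -/
theorem stmt4 {E : Type*} [NormedAddCommGroup E] [NormedSpace ℝ E]
    [FiniteDimensional ℝ E]
    (p : ℝ) (hp : 1 ≤ p) {n : ℕ} (x : Fin n → E) :
    ContinuousOn (fun ξ => (dualQuantFp p x ξ).toReal) (convexHull ℝ (Set.range x)) := by
  have hp₀ : 0 ≤ p := zero_le_one.trans hp
  intro ξ hξ
  obtain ⟨l₀, hl₀, hl₀ξ, hl₀f⟩ := exists_dualQuantFp_toReal_eq p x hξ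
  refine tendsto_of_subseq_tendsto fun u hu => ?_
  obtain ⟨hlim, hmem⟩ := tendsto_nhdsWithin_iff.1 hu
  obtain ⟨N, hN⟩ := eventually_atTop.1 hmem
  have hlimN : Tendsto (fun k => u (k + N)) atTop (𝓝 ξ) := hlim.comp (tendsto_add_atTop_nat N)
  obtain ⟨l, φ, hφ, hl, hlu, hll₀⟩ := exists_seq_stdSimplex_tendsto x hl₀
    (fun k => hN (k + N) (Nat.le_add_left N k)) (hl₀ξ ▸ hlimN)
  choose m hm hmu hmf using fun k =>
    exists_dualQuantFp_toReal_eq p x (hN (φ k + N) (Nat.le_add_left N _))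
  obtain ⟨μ, hμ, ψ, hψ, hψμ⟩ := (isCompact_stdSimplex ℝ (Fin n)).tendsto_subseq hm
  have hlimψ : Tendsto (fun k => u (φ (ψ k) + N)) atTop (𝓝 ξ) :=
    hlimN.comp (hφ.comp hψ).tendsto_atTop
  have hμξ : ∑ i, μ i • x i = ξ := by
    refine tendsto_nhds_unique (((continuous_sum_smul_const x).tendsto μ).comp hψμ) ?_
    exact hlimψ.congr fun k => (hmu (ψ k)).symm
  have hlow := tendsto_sum_mul_norm_sub_rpow hp₀ x hψμ hlimψ
  have hupp := tendsto_sum_mul_norm_sub_rpow hp₀ x (hll₀.comp hψ.tendsto_atTop) hlimψ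
  have hle : ∀ k, ∑ i, m (ψ k) i * ‖u (φ (ψ k) + N) - x i‖ ^ p ≤
      ∑ i, l (ψ k) i * ‖u (φ (ψ k) + N) - x i‖ ^ p := fun k =>
    (hmf (ψ k)).symm.trans_le (dualQuantFp_toReal_le p x (hl (ψ k)) (hlu (ψ k)))
  have heq : ∑ i, μ i * ‖ξ - x i‖ ^ p = (dualQuantFp p x ξ).toReal :=
    le_antisymm ((le_of_tendsto_of_tendsto' hlow hupp hle).trans_eq hl₀f.symm)
      (dualQuantFp_toReal_le p x hμ hμξ)
  refine ⟨fun k => φ (ψ k) + N, ?_⟩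
  rw [heq] at hlow
  exact hlow.congr fun k => (hmf (ψ k)).symm
end

section
/- Let Γ = {x_1,…,x_n} ⊂ ℝ^d with affine dimension d and p ∈ [1,∞). For each I ∈ 𝓘(Γ) (i.e. I ⊂ {1,…,n}, |I| = d+1, and {x_j : j ∈ I} affinely independent), define the optimality region D_I(Γ) = { ξ ∈ ℝ^d : the barycentric coordinates λ(ξ) of ξ with respect to (x_j)_{j∈I} satisfy λ(ξ) ≥ 0 and Σ_{j∈I} λ_j(ξ) ‖ξ − x_j‖^p = F^p(ξ;Γ) }. Then: (a) for every I ∈ 𝓘(Γ), {x_j : j ∈ I} ⊆ D_I(Γ) ⊆ conv{x_j : j ∈ I} and D_I(Γ) is closed (hence Borel); (b) the family (D_I(Γ))_{I∈𝓘(Γ)} covers conv(Γ), i.e. ⋃_{I∈𝓘(Γ)} D_I(Γ) = conv(Γ). -/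
open MeasureTheory Set
open scoped ENNReal

/-- Optimality region `D_I(Γ)`: the set of points `ξ` whose barycentric coordinates w.r.t.
`(x_j)_{j∈I}` (i.e. the weights supported on `I` summing to `1` and with barycenter `ξ`)
are nonnegative and achieve `F^p(ξ;Γ)`. -/
def dualQuantD {E : Type*} [NormedAddCommGroup E] [NormedSpace ℝ E]
    (p : ℝ) {n : ℕ} (x : Fin n → E) (I : Finset (Fin n)) : Set E :=
  {ξ | ∃ w : Fin n → ℝ, (∀ i, 0 ≤ w i) ∧ (∀ i ∉ I, w i = 0) ∧
    ∑ i, w i = 1 ∧ ∑ i, w i • x i = ξ ∧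
    ENNReal.ofReal (∑ i, w i * ‖ξ - x i‖ ^ p) = dualQuantFp p x ξ}

/-- Nonnegative weights summing to `1` with barycenter `ξ`. -/
def IsBarycentricWeight {E : Type*} [NormedAddCommGroup E] [NormedSpace ℝ E]
    {n : ℕ} (x : Fin n → E) (ξ : E) (w : Fin n → ℝ) : Prop :=
  (∀ i, 0 ≤ w i) ∧ ∑ i, w i = 1 ∧ ∑ i, w i • x i = ξ

section

variable {E : Type*} [NormedAddCommGroup E] [NormedSpace ℝ E] {n : ℕ} {x : Fin n → E}

theorem mem_dualQuantD_iff {p : ℝ} {I : Finset (Fin n)} {ξ : E} :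
    ξ ∈ dualQuantD p x I ↔ ∃ w, IsBarycentricWeight x ξ w ∧ (∀ i ∉ I, w i = 0) ∧
      ∀ v, IsBarycentricWeight x ξ v →
        ∑ i, w i * ‖ξ - x i‖ ^ p ≤ ∑ i, v i * ‖ξ - x i‖ ^ p := by
  constructor
  · rintro ⟨w, h0, hI, h1, hb, he⟩
    refine ⟨w, ⟨h0, h1, hb⟩, hI, fun v hv => ?_⟩
    have hle : ENNReal.ofReal (∑ i, w i * ‖ξ - x i‖ ^ p)
        ≤ ENNReal.ofReal (∑ i, v i * ‖ξ - x i‖ ^ p) := by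
      rw [he]
      exact iInf_le_of_le ⟨v, hv⟩ le_rfl
    exact (ENNReal.ofReal_le_ofReal_iff
      (Finset.sum_nonneg fun i _ => mul_nonneg (hv.1 i) (by positivity))).1 hle
  · rintro ⟨w, hw, hI, hmin⟩
    exact ⟨w, hw.1, hI, hw.2.1, hw.2.2, le_antisymm
      (le_iInf fun v => ENNReal.ofReal_le_ofReal (hmin v.1 v.2))
      (iInf_le_of_le ⟨w, hw⟩ le_rfl)⟩

theorem isBarycentricWeight_single (x : Fin n → E) (j : Fin n) :
    IsBarycentricWeight x (x j) (Pi.single j 1) := by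
  refine ⟨fun i => ?_, by simp, by simp [Pi.single_apply]⟩
  rcases eq_or_ne i j with rfl | h <;> simp [*]

theorem self_mem_dualQuantD {p : ℝ} (hp : p ≠ 0) {I : Finset (Fin n)} {j : Fin n} (hj : j ∈ I) :
    x j ∈ dualQuantD p x I := by
  refine mem_dualQuantD_iff.2 ⟨Pi.single j 1, isBarycentricWeight_single x j,
    fun i hi => ?_, fun v hv => ?_⟩
  · rw [Pi.single_eq_of_ne]
    rintro rfl
    exact hi hj
  · have hz : ∑ i, (Pi.single j 1 : Fin n → ℝ) i * ‖x j - x i‖ ^ p = 0 := by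
      simp [Pi.single_apply, Real.zero_rpow hp]
    rw [hz]
    exact Finset.sum_nonneg fun i _ => mul_nonneg (hv.1 i) (by positivity)

theorem dualQuantD_subset_convexHull (p : ℝ) (x : Fin n → E) (I : Finset (Fin n)) :
    dualQuantD p x I ⊆ convexHull ℝ (x '' ↑I) := by
  rintro ξ ⟨w, h0, hI, h1, rfl, -⟩
  have hs : ∑ i ∈ I, w i • x i = ∑ i, w i • x i :=
    Finset.sum_subset (Finset.subset_univ _) fun i _ hi => by simp [hI i hi]
  rw [← hs]
  refine (convex_convexHull ℝ _).sum_mem (fun i _ => h0 i) ?_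
    fun i hi => subset_convexHull ℝ _ ⟨i, hi, rfl⟩
  rw [← h1]
  exact Finset.sum_subset (Finset.subset_univ _) fun i _ hi => hI i hi

/-- If `w` has weights close to those of an optimal `v` (so that `w / 2 ≤ v`), optimality of `v`
at `η` forces `w` to be at least as cheap at `η` as any weight with the same barycenter. -/
theorem sum_le_sum_of_half_le {c : Fin n → ℝ} {ξ η : E} {u v w : Fin n → ℝ}
    (hu : IsBarycentricWeight x ξ u) (hw : IsBarycentricWeight x ξ w)
    (hv : IsBarycentricWeight x η v) (hwv : ∀ i, w i / 2 ≤ v i)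
    (hmin : ∀ v', IsBarycentricWeight x η v' → ∑ i, v i * c i ≤ ∑ i, v' i * c i) :
    ∑ i, w i * c i ≤ ∑ i, u i * c i := by
  have h := hmin (fun i => v i + (1 / 2 : ℝ) * (u i - w i)) ⟨fun i => ?_, ?_, ?_⟩
  · simp only [add_mul, mul_assoc, sub_mul, Finset.sum_add_distrib, ← Finset.mul_sum,
      Finset.sum_sub_distrib] at h
    linarith
  · linarith [hu.1 i, hwv i]
  · simp only [Finset.sum_add_distrib, ← Finset.mul_sum, Finset.sum_sub_distrib,
      hu.2.1, hw.2.1, hv.2.1]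
    norm_num
  · simp only [add_smul, mul_smul, sub_smul, Finset.sum_add_distrib, ← Finset.smul_sum,
      Finset.sum_sub_distrib, hu.2.2, hw.2.2, hv.2.2]
    simp

theorem isClosed_dualQuantD {p : ℝ} (hp : 0 ≤ p) (x : Fin n → E) (I : Finset (Fin n)) :
    IsClosed (dualQuantD p x I) := by
  refine IsSeqClosed.isClosed fun ξ ξ₀ hξ hlim => ?_
  choose v hv hvI hmin using fun k => mem_dualQuantD_iff.1 (hξ k)
  obtain ⟨w, hw, φ, hφ, hvw⟩ := (isCompact_stdSimplex ℝ (Fin n)).tendsto_subseq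
    fun k => (⟨(hv k).1, (hv k).2.1⟩ : v k ∈ stdSimplex ℝ (Fin n))
  have hξφ : Filter.Tendsto (fun k => ξ (φ k)) Filter.atTop (nhds ξ₀) :=
    hlim.comp hφ.tendsto_atTop
  have hvi : ∀ i, Filter.Tendsto (fun k => v (φ k) i) Filter.atTop (nhds (w i)) :=
    fun i => tendsto_pi_nhds.1 hvw i
  have hwb : IsBarycentricWeight x ξ₀ w := by
    refine ⟨hw.1, hw.2, tendsto_nhds_unique
      (tendsto_finsetSum Finset.univ fun i _ => (hvi i).smul_const (x i)) ?_⟩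
    simpa only [(hv _).2.2] using hξφ
  refine mem_dualQuantD_iff.2 ⟨w, hwb, fun i hi => ?_, fun u hu => ?_⟩
  · exact tendsto_nhds_unique (hvi i) (by simp [hvI _ i hi])
  · have hev : ∀ᶠ k in Filter.atTop, ∀ i, w i / 2 ≤ v (φ k) i := by
      refine Filter.eventually_all.2 fun i => ?_
      rcases (hw.1 i).eq_or_lt with h0 | h0
      · exact Filter.Eventually.of_forall fun k => by simpa [← h0] using (hv (φ k)).1 i
      · exact (hvi i).eventually_const_le (by linarith)
    have hcost : ∀ z : Fin n → ℝ, Filter.Tendsto (fun k => ∑ i, z i * ‖ξ (φ k) - x i‖ ^ p)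
        Filter.atTop (nhds (∑ i, z i * ‖ξ₀ - x i‖ ^ p)) := fun z =>
      tendsto_finsetSum _ fun i _ =>
        (((hξφ.sub_const (x i)).norm).rpow_const (Or.inr hp)).const_mul (z i)
    exact le_of_tendsto_of_tendsto (hcost w) (hcost u) (hev.mono fun k hk =>
      sum_le_sum_of_half_le hu hwb (hv _) hk (hmin _))

/-- A nontrivial affine dependency among the points indexed by `S`, extended by zero. -/
theorem exists_affine_dependency {S : Finset (Fin n)}
    (hS : ¬ AffineIndependent ℝ (fun j : S => x j)) :
    ∃ u : Fin n → ℝ, (∀ i ∉ S, u i = 0) ∧ ∑ i, u i = 0 ∧ ∑ i, u i • x i = 0 ∧ ∃ i, u i ≠ 0 := by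
  rw [affineIndependent_iff] at hS
  push Not at hS
  obtain ⟨s, w, h0, hx, e, he, hne⟩ := hS
  let u : Fin n → ℝ := fun i => if h : i ∈ S then (if (⟨i, h⟩ : S) ∈ s then w ⟨i, h⟩ else 0) else 0
  have huS : ∀ i ∉ S, u i = 0 := fun i hi => by simp [u, hi]
  have hue : ∀ j : S, u j = if j ∈ s then w j else 0 := fun j => by simp [u]
  refine ⟨u, huS, ?_, ?_, e, by simpa [hue, he] using hne⟩
  · rw [← Finset.sum_subset (Finset.subset_univ S) fun i _ hi => huS i hi,
      ← Finset.sum_coe_sort S u]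
    simp only [hue]
    rwa [← Finset.sum_filter, Finset.filter_mem_eq_inter, Finset.univ_inter]
  · rw [← Finset.sum_subset (Finset.subset_univ S) fun i _ hi => by simp [huS i hi],
      ← Finset.sum_coe_sort S (fun i => u i • x i)]
    simp only [hue, ite_smul, zero_smul]
    rwa [← Finset.sum_filter, Finset.filter_mem_eq_inter, Finset.univ_inter]

/-- Moving along a direction `u` with some negative entry and total `0` until a weight vanishes. -/
theorem exists_nonneg_add_mul_eq_zero {w u : Fin n → ℝ} (hw : ∀ i, 0 ≤ w i)
    (hu : ∃ i, u i < 0) :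
    ∃ t : ℝ, 0 ≤ t ∧ (∀ i, 0 ≤ w i + t * u i) ∧ ∃ i, u i < 0 ∧ w i + t * u i = 0 := by
  obtain ⟨i₀, hi₀⟩ := hu
  obtain ⟨j, hj, hmin⟩ := Finset.exists_min_image (Finset.univ.filter fun i => u i < 0)
    (fun i => w i / -u i) ⟨i₀, by simpa using hi₀⟩
  have hju : u j < 0 := by simpa using hj
  have ht : 0 ≤ w j / -u j := div_nonneg (hw j) (by linarith)
  refine ⟨w j / -u j, ht, fun i => ?_, j, hju, ?_⟩
  · rcases lt_or_ge (u i) 0 with h | h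
    · have := (le_div_iff₀ (by linarith : 0 < -u i)).1 (hmin i (by simpa using h))
      linarith
    · have := mul_nonneg ht h
      linarith [hw i]
  · have : u j ≠ 0 := hju.ne
    field_simp
    ring

/-- A linear cost on the weights with barycenter `ξ` attains its minimum at a weight whose support
is affinely independent. -/
theorem exists_min_affineIndependent_support {ξ : E}
    (hne : ∃ w, IsBarycentricWeight x ξ w) (c : Fin n → ℝ) :
    ∃ w, IsBarycentricWeight x ξ w ∧
      (∀ v, IsBarycentricWeight x ξ v → ∑ i, w i * c i ≤ ∑ i, v i * c i) ∧
      AffineIndependent ℝ (fun j : (Finset.univ.filter fun i => w i ≠ 0) => x j) := by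
  let M : Set (Fin n → ℝ) := {w | IsBarycentricWeight x ξ w ∧
    ∀ v, IsBarycentricWeight x ξ v → ∑ i, w i * c i ≤ ∑ i, v i * c i}
  have hM : M.Nonempty := by
    have hcomp : IsCompact {w | IsBarycentricWeight x ξ w} := by
      have hset : {w | IsBarycentricWeight x ξ w} =
          stdSimplex ℝ (Fin n) ∩ {w | ∑ i, w i • x i = ξ} := by
        ext w
        simp [IsBarycentricWeight, stdSimplex, and_assoc]
      rw [hset]
      exact (isCompact_stdSimplex ℝ (Fin n)).inter_right
        (isClosed_eq (by fun_prop) continuous_const)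
    obtain ⟨w, hw, hmin⟩ := hcomp.exists_isMinOn hne
      (f := fun w : Fin n → ℝ => ∑ i, w i * c i) (by fun_prop)
    exact ⟨w, hw, fun v hv => hmin hv⟩
  let supp : (Fin n → ℝ) → Finset (Fin n) := fun w => Finset.univ.filter fun i => w i ≠ 0
  obtain ⟨w, ⟨hw, hmin⟩, hcard⟩ :=
    exists_minimalFor_of_wellFoundedLT (fun w => w ∈ M) (fun w => (supp w).card) hM
  refine ⟨w, hw, hmin, ?_⟩
  by_contra hdep
  obtain ⟨u, huS, hu0, hux, k, hk⟩ := exists_affine_dependency hdep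
  wlog hcu : ∑ i, u i * c i ≤ 0 generalizing u
  · exact this (fun i => -u i) (fun i hi => by simp [huS i hi]) (by simp [hu0]) (by simp [hux])
      (by simpa using hk) (by simp only [neg_mul, Finset.sum_neg_distrib]; linarith)
  have hneg : ∃ i, u i < 0 := by
    by_contra! h
    exact hk ((Finset.sum_eq_zero_iff_of_nonneg fun i _ => h i).1 hu0 k (Finset.mem_univ k))
  obtain ⟨t, ht, hnn, j, hj, hj0⟩ := exists_nonneg_add_mul_eq_zero hw.1 hneg
  let w' : Fin n → ℝ := fun i => w i + t * u i
  have hw' : w' ∈ M := by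
    refine ⟨⟨hnn, ?_, ?_⟩, fun v hv => le_trans ?_ (hmin v hv)⟩
    · simp [w', Finset.sum_add_distrib, ← Finset.mul_sum, hu0, hw.2.1]
    · simp [w', add_smul, mul_smul, Finset.sum_add_distrib, ← Finset.smul_sum, hux, hw.2.2]
    · simp only [w', add_mul, mul_assoc, Finset.sum_add_distrib, ← Finset.mul_sum]
      linarith [mul_nonpos_of_nonneg_of_nonpos ht hcu]
  have hlt : supp w' ⊂ supp w := by
    have hjw : w j ≠ 0 := fun h => hj.ne (huS j (by simp [h]))
    refine Finset.ssubset_iff_of_subset (fun i hi => ?_) |>.2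
      ⟨j, by simpa [supp] using hjw, by simpa [supp, w'] using hj0⟩
    by_contra h
    have hwi : w i = 0 := by simpa [supp] using h
    have hui : u i = 0 := huS i (by simp [hwi])
    simp [supp, w', hwi, hui] at hi
  exact (Finset.card_lt_card hlt).not_ge (hcard hw' (Finset.card_lt_card hlt).le)

/-- An affinely independent subfamily of a family spanning the whole space extends to an
affinely independent subfamily with `finrank + 1` members. -/
theorem exists_superset_affineIndependent_card_eq [FiniteDimensional ℝ E]
    (hspan : affineSpan ℝ (Set.range x) = ⊤) {S : Finset (Fin n)}
    (hS : AffineIndependent ℝ (fun j : S => x j)) :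
    ∃ I, S ⊆ I ∧ I.card = Module.finrank ℝ E + 1 ∧ AffineIndependent ℝ (fun j : I => x j) := by
  obtain ⟨I, hSI, hI⟩ := (Set.toFinite {I : Finset (Fin n) |
    AffineIndependent ℝ (fun j : I => x j)}).exists_le_maximal hS
  have hind : AffineIndependent ℝ (fun j : I => x j) := hI.prop
  refine ⟨I, hSI, ?_, hind⟩
  have htop : affineSpan ℝ (Set.range fun j : I => x j) = ⊤ := by
    refine top_unique (hspan ▸ affineSpan_le.2 ?_)
    rintro _ ⟨k, rfl⟩
    by_contra hk
    have hkI : k ∉ I := fun h => hk (subset_affineSpan ℝ _ ⟨⟨k, h⟩, rfl⟩)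
    let k' : (insert k I : Finset (Fin n)) := ⟨k, Finset.mem_insert_self k I⟩
    have hins : AffineIndependent ℝ (fun j : (insert k I : Finset (Fin n)) => x j) := by
      refine AffineIndependent.affineIndependent_of_notMem_span (i := k') ?_ ?_
      · let f : {y : (insert k I : Finset (Fin n)) // y ≠ k'} ↪ I :=
          ⟨fun y => ⟨y.1.1, (Finset.mem_insert.1 y.1.2).resolve_left
            fun h => y.2 (Subtype.ext h)⟩, fun a b h =>
            Subtype.ext (Subtype.ext (congrArg (fun z : I => (z : Fin n)) h))⟩
        exact hind.comp_embedding f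
      · refine fun h => hk (affineSpan_mono ℝ ?_ h)
        rintro _ ⟨y, hy, rfl⟩
        exact ⟨⟨y.1, (Finset.mem_insert.1 y.2).resolve_left fun h => hy (Subtype.ext h)⟩, rfl⟩
    exact hkI (hI.le_of_ge hins (Finset.subset_insert k I) (Finset.mem_insert_self k I))
  rw [← Fintype.card_coe]
  exact hind.affineSpan_eq_top_iff_card_eq_finrank_add_one.1 htop

theorem exists_isBarycentricWeight_of_mem_convexHull {ξ : E}
    (hξ : ξ ∈ convexHull ℝ (Set.range x)) : ∃ w, IsBarycentricWeight x ξ w := by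
  refine convexHull_min (t := {ξ | ∃ w, IsBarycentricWeight x ξ w}) ?_ ?_ hξ
  · rintro _ ⟨j, rfl⟩
    exact ⟨_, isBarycentricWeight_single x j⟩
  · rintro _ ⟨v, hv0, hv1, rfl⟩ _ ⟨w, hw0, hw1, rfl⟩ a b ha hb hab
    refine ⟨fun i => a * v i + b * w i, fun i => ?_, ?_, ?_⟩
    · exact add_nonneg (mul_nonneg ha (hv0 i)) (mul_nonneg hb (hw0 i))
    · simp [Finset.sum_add_distrib, ← Finset.mul_sum, hv1, hw1, hab]
    · simp [add_smul, mul_smul, Finset.sum_add_distrib, Finset.smul_sum]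

end

/-- Let `Γ = {x_1,…,x_n} ⊂ ℝ^d` have affine dimension `d` and `p ∈ [1,∞)`.
(a) For every `I ∈ 𝓘(Γ)` (i.e. `|I| = d+1` and `(x_j)_{j∈I}` affinely independent),
`{x_j : j ∈ I} ⊆ D_I(Γ) ⊆ conv{x_j : j ∈ I}` and `D_I(Γ)` is closed;
(b) `⋃_{I ∈ 𝓘(Γ)} D_I(Γ) = conv(Γ)`. -/
theorem stmt5 {E : Type*} [NormedAddCommGroup E] [NormedSpace ℝ E]
    [FiniteDimensional ℝ E]
    (p : ℝ) (hp : 1 ≤ p) {n : ℕ} (x : Fin n → E)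
    (hspan : affineSpan ℝ (Set.range x) = ⊤) :
    (∀ I : Finset (Fin n), I.card = Module.finrank ℝ E + 1 →
      AffineIndependent ℝ (fun j : I => x j) →
      ((∀ j ∈ I, x j ∈ dualQuantD p x I) ∧
        dualQuantD p x I ⊆ convexHull ℝ (x '' ↑I) ∧
        IsClosed (dualQuantD p x I))) ∧
    (⋃ I ∈ {I : Finset (Fin n) | I.card = Module.finrank ℝ E + 1 ∧
        AffineIndependent ℝ (fun j : I => x (j : Fin n))}, dualQuantD p x I)
      = convexHull ℝ (Set.range x) := by
  have hp0 : 0 < p := by linarith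
  refine ⟨fun I _ _ => ⟨fun j hj => self_mem_dualQuantD hp0.ne' hj,
    dualQuantD_subset_convexHull p x I, isClosed_dualQuantD hp0.le x I⟩, ?_⟩
  refine Set.Subset.antisymm (Set.iUnion₂_subset fun I _ =>
    (dualQuantD_subset_convexHull p x I).trans (convexHull_mono (Set.image_subset_range _ _))) ?_
  intro ξ hξ
  obtain ⟨w, hw, hmin, hind⟩ := exists_min_affineIndependent_support
    (exists_isBarycentricWeight_of_mem_convexHull hξ) fun i => ‖ξ - x i‖ ^ p
  obtain ⟨I, hSI, hI⟩ := exists_superset_affineIndependent_card_eq hspan hind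
  refine Set.mem_iUnion₂.2 ⟨I, hI, mem_dualQuantD_iff.2 ⟨w, hw, fun i hi => ?_, hmin⟩⟩
  by_contra h
  exact hi (hSI (by simpa using h))
end

section
/- Let X be a random vector in ℝ^d with compactly supported distribution, let Γ = {x_1,…,x_n} ⊂ ℝ^d be a finite grid with conv(Γ) ⊇ supp(P_X), and let Ŷ be a random vector (possibly defined on an enlarged probability space carrying X) taking values in Γ and satisfying E(Ŷ | X) = X almost surely. Then for every function F : ℝ^d → ℝ which is differentiable in a neighborhood of conv(Γ) with Lipschitz continuous differential F' on conv(Γ), |E F(X) − E F(Ŷ)| ≤ [F']_Lip · E ‖X − Ŷ‖^2. -/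
open MeasureTheory Set
open scoped ENNReal

/-- The support of a measure: points all of whose neighbourhoods have positive mass. -/
def measSupport {E : Type*} [TopologicalSpace E] [MeasurableSpace E] (ν : Measure E) : Set E :=
  {x | ∀ U ∈ nhds x, 0 < ν U}

theorem ae_mem_measSupport {E : Type*} [TopologicalSpace E] [HereditarilyLindelofSpace E]
    [MeasurableSpace E] (ν : Measure E) : ∀ᵐ x ∂ν, x ∈ measSupport ν := by
  have h : measSupport ν = ν.support := by
    ext x
    exact (Measure.mem_support_iff_forall x).symm
  rw [h]
  exact Measure.support_mem_ae

/-- First-order Taylor bound on a convex set for a function with Lipschitz differential. -/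
theorem Convex.norm_sub_sub_fderiv_le {E : Type*} [NormedAddCommGroup E] [NormedSpace ℝ E]
    {K : Set E} (hK : Convex ℝ K) {F : E → ℝ} (hF : ∀ x ∈ K, DifferentiableAt ℝ F x)
    {L : NNReal} (hLip : LipschitzOnWith L (fderiv ℝ F) K) {x y : E} (hx : x ∈ K) (hy : y ∈ K) :
    ‖F y - F x - fderiv ℝ F x (y - x)‖ ≤ L * ‖y - x‖ ^ 2 := by
  have hseg : segment ℝ x y ⊆ K := hK.segment_subset hx hy
  have h := (convex_segment x y).norm_image_sub_le_of_norm_fderiv_le'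
    (φ := fderiv ℝ F x) (C := L * ‖y - x‖) (fun z hz => hF z (hseg hz)) ?_
    (left_mem_segment ℝ x y) (right_mem_segment ℝ x y)
  · rwa [sq, ← mul_assoc]
  · intro z hz
    grw [hLip.norm_sub_le (hseg hz) hx]
    gcongr
    rw [segment_eq_image'] at hz
    obtain ⟨t, ht, rfl⟩ := hz
    rw [add_sub_cancel_left, norm_smul, Real.norm_of_nonneg ht.1]
    exact mul_le_of_le_one_left (norm_nonneg _) ht.2

theorem integrable_comp_of_continuousOn_isCompact {E G : Type*} [TopologicalSpace E]
    [T2Space E] [TopologicalSpace.PseudoMetrizableSpace E]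
    [MeasurableSpace E] [BorelSpace E] [NormedAddCommGroup G]
    {Ω : Type*} [MeasurableSpace Ω] {μ : Measure Ω} [IsFiniteMeasure μ] {Z : Ω → E}
    (hZ : Measurable Z) {K : Set E} (hK : IsCompact K) (hZK : ∀ᵐ ω ∂μ, Z ω ∈ K)
    {f : E → G} (hf : ContinuousOn f K) : Integrable (fun ω => f (Z ω)) μ := by
  have h : IntegrableOn f K (μ.map Z) := hf.integrableOn_compact' hK hK.measurableSet
  have hZK' : ∀ᵐ x ∂μ.map Z, x ∈ K := (ae_map_iff hZ.aemeasurable hK.measurableSet).2 hZK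
  rw [IntegrableOn, Measure.restrict_eq_self_of_ae_mem hZK'] at h
  exact h.comp_measurable hZ

/-- If `E(Y | m) = X` then `Y - X` is orthogonal to every `m`-measurable field of linear forms. -/
theorem integral_clm_apply_sub_eq_zero {E : Type*} [NormedAddCommGroup E] [NormedSpace ℝ E]
    [CompleteSpace E] {Ω : Type*} {m m₀ : MeasurableSpace Ω} {μ : Measure Ω} [IsFiniteMeasure μ]
    (hm : m ≤ m₀) {X Y : Ω → E} (hY : Integrable Y μ)
    (hstat : μ[Y | m] =ᵐ[μ] X) {A : Ω → E →L[ℝ] ℝ} (hA : StronglyMeasurable[m] A)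
    (hAX : Integrable (fun ω => A ω (X ω)) μ) (hAY : Integrable (fun ω => A ω (Y ω)) μ) :
    ∫ ω, A ω (Y ω - X ω) ∂μ = 0 := by
  have h := condExp_bilin_of_stronglyMeasurable_left (ContinuousLinearMap.id ℝ (E →L[ℝ] ℝ))
    hA hAY hY
  have hint : ∫ ω, A ω (Y ω) ∂μ = ∫ ω, A ω (X ω) ∂μ := by
    rw [← integral_condExp hm]
    refine integral_congr_ae ?_
    filter_upwards [h, hstat] with ω h₁ h₂
    rw [← h₂]
    exact h₁
  simp_rw [map_sub]
  rw [integral_sub hAY hAX, hint, sub_self]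

/-- Let `X` be a compactly supported random vector in `ℝ^d`, `Γ` a finite grid
with `conv(Γ) ⊇ supp(P_X)`, and `Ŷ` a `Γ`-valued random vector with `E(Ŷ | X) = X` a.s.
Then for every `F` differentiable on a neighbourhood of `conv(Γ)` whose differential is
`L`-Lipschitz on `conv(Γ)`, `|E F(X) − E F(Ŷ)| ≤ L · E ‖X − Ŷ‖²`. -/
theorem stmt7 {E : Type*} [NormedAddCommGroup E] [NormedSpace ℝ E]
    [FiniteDimensional ℝ E] [MeasurableSpace E] [BorelSpace E]
    {Ω : Type*} [MeasurableSpace Ω] {μ : Measure Ω} [IsProbabilityMeasure μ]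
    (X Y : Ω → E) (hX : Measurable X) (hY : Measurable Y)
    (hcomp : IsCompact (measSupport (μ.map X)))
    (Γ : Finset E) (hsupp : measSupport (μ.map X) ⊆ convexHull ℝ (Γ : Set E))
    (hYΓ : ∀ ω, Y ω ∈ Γ)
    (hstat : μ[Y | MeasurableSpace.comap X inferInstance] =ᵐ[μ] X)
    (F : E → ℝ) (U : Set E) (hU : IsOpen U) (hUΓ : convexHull ℝ (Γ : Set E) ⊆ U)
    (hF : DifferentiableOn ℝ F U) (L : NNReal)
    (hLip : LipschitzOnWith L (fderiv ℝ F) (convexHull ℝ (Γ : Set E))) :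
    |(∫ ω, F (X ω) ∂μ) - ∫ ω, F (Y ω) ∂μ| ≤
      (L : ℝ) * ∫ ω, ‖X ω - Y ω‖ ^ 2 ∂μ := by
  have : CompleteSpace E := FiniteDimensional.complete ℝ E
  have : ProperSpace E := FiniteDimensional.proper ℝ E
  have : ProperSpace (E →L[ℝ] ℝ) := FiniteDimensional.proper ℝ _
  set K : Set E := convexHull ℝ (Γ : Set E)
  have hKc : IsCompact K := Γ.finite_toSet.isCompact_convexHull ℝ
  have hXK : ∀ᵐ ω ∂μ, X ω ∈ K :=
    (ae_of_ae_map hX.aemeasurable (ae_mem_measSupport _)).mono fun _ h => hsupp h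
  have hYK : ∀ᵐ ω ∂μ, Y ω ∈ K := ae_of_all _ fun ω => subset_convexHull ℝ _ (hYΓ ω)
  have hdiff : ∀ x ∈ K, DifferentiableAt ℝ F x := fun x hx =>
    hF.differentiableAt (hU.mem_nhds (hUΓ hx))
  have hFc : ContinuousOn F K := fun x hx => (hdiff x hx).continuousAt.continuousWithinAt
  have hXY : Measurable fun ω => (X ω, Y ω) := hX.prodMk hY
  have hXYK : ∀ᵐ ω ∂μ, (X ω, Y ω) ∈ K ×ˢ K := by
    filter_upwards [hXK, hYK] with ω h₁ h₂ using ⟨h₁, h₂⟩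
  have hYi : Integrable Y μ :=
    integrable_comp_of_continuousOn_isCompact hY hKc hYK continuousOn_id
  have hFX := integrable_comp_of_continuousOn_isCompact hX hKc hXK hFc
  have hFY := integrable_comp_of_continuousOn_isCompact hY hKc hYK hFc
  have hsq : Integrable (fun ω => ‖X ω - Y ω‖ ^ 2) μ :=
    integrable_comp_of_continuousOn_isCompact (f := fun p : E × E => ‖p.1 - p.2‖ ^ 2)
      hXY (hKc.prod hKc) hXYK (by fun_prop)
  have hDX : Integrable (fun ω => fderiv ℝ F (X ω) (X ω)) μ :=
    integrable_comp_of_continuousOn_isCompact (f := fun x => fderiv ℝ F x x) hX hKc hXK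
      (hLip.continuousOn.clm_apply continuousOn_id)
  have hDY : Integrable (fun ω => fderiv ℝ F (X ω) (Y ω)) μ :=
    integrable_comp_of_continuousOn_isCompact (f := fun p : E × E => fderiv ℝ F p.1 p.2)
      hXY (hKc.prod hKc) hXYK
      ((hLip.continuousOn.comp continuousOn_fst fun _ hp => hp.1).clm_apply continuousOn_snd)
  have hzero : ∫ ω, fderiv ℝ F (X ω) (Y ω - X ω) ∂μ = 0 :=
    integral_clm_apply_sub_eq_zero hX.comap_le hYi hstat
      ((measurable_fderiv ℝ F).comp (comap_measurable X)).stronglyMeasurable hDX hDY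
  have hD : Integrable (fun ω => fderiv ℝ F (X ω) (Y ω - X ω)) μ := by
    simpa only [map_sub] using hDY.sub' hDX
  have heq : (∫ ω, F (Y ω) ∂μ) - ∫ ω, F (X ω) ∂μ =
      ∫ ω, (F (Y ω) - F (X ω) - fderiv ℝ F (X ω) (Y ω - X ω)) ∂μ := by
    rw [integral_sub (hFY.sub' hFX) hD, integral_sub hFY hFX, hzero, sub_zero]
  rw [abs_sub_comm, heq, ← integral_const_mul, ← Real.norm_eq_abs]
  refine norm_integral_le_of_norm_le (hsq.const_mul _) ?_
  filter_upwards [hXK, hYK] with ω h₁ h₂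
  rw [norm_sub_rev (X ω)]
  exact (convex_convexHull ℝ _).norm_sub_sub_fderiv_le hdiff hLip h₁ h₂
end

section
/- Equip ℝ^d with the canonical p-norm |x|_p = (Σ_{j=1}^d |x_j|^p)^{1/p}, p ∈ [1,∞). Let α_1,…,α_d ⊂ ℝ be finite sets and let Γ = α_1 × … × α_d be the product grid. Then for every ξ = (ξ_1,…,ξ_d) ∈ ℝ^d, F^p(ξ;Γ) = Σ_{j=1}^d F^p(ξ_j; α_j). -/
open MeasureTheory Set
open scoped ENNReal

/-- `p`-th power of the local dual quantization error `F_p(ξ; Γ)^p` for a finite grid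
`Γ : Finset E`, with the convention `inf ∅ = +∞`. -/
noncomputable def dualQuantFpF {E : Type*} [NormedAddCommGroup E] [NormedSpace ℝ E]
    (p : ℝ) (Γ : Finset E) (ξ : E) : ℝ≥0∞ :=
  ⨅ l : {l : E → ℝ // (∀ y, 0 ≤ l y) ∧ ∑ y ∈ Γ, l y = 1 ∧ ∑ y ∈ Γ, l y • y = ξ},
    ENNReal.ofReal (∑ y ∈ Γ, l.1 y * ‖ξ - y‖ ^ p)

lemma dualQuantFpF_le {E : Type*} [NormedAddCommGroup E] [NormedSpace ℝ E]
    (p : ℝ) (Γ : Finset E) (ξ : E) (l : E → ℝ) (h0 : ∀ y, 0 ≤ l y) (h1 : ∑ y ∈ Γ, l y = 1)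
    (hξ : ∑ y ∈ Γ, l y • y = ξ) :
    dualQuantFpF p Γ ξ ≤ ENNReal.ofReal (∑ y ∈ Γ, l y * ‖ξ - y‖ ^ p) :=
  iInf_le (fun l : {l : E → ℝ // (∀ y, 0 ≤ l y) ∧ ∑ y ∈ Γ, l y = 1 ∧ ∑ y ∈ Γ, l y • y = ξ} ↦
    ENNReal.ofReal (∑ y ∈ Γ, l.1 y * ‖ξ - y‖ ^ p)) ⟨l, h0, h1, hξ⟩

/-- Integrating a function of one coordinate against weights on a product grid is integrating
against the marginal weights. -/
lemma sum_piFinset_mul_apply {ι : Type*} [Fintype ι] [DecidableEq ι] (α : ι → Finset ℝ)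
    (L : (ι → ℝ) → ℝ) (g : ℝ → ℝ) (j : ι) :
    ∑ a ∈ α j, (∑ y ∈ Fintype.piFinset α with y j = a, L y) * g a
      = ∑ y ∈ Fintype.piFinset α, L y * g (y j) := by
  rw [← Finset.sum_fiberwise_of_maps_to (t := α j) (g := fun y : ι → ℝ ↦ y j)
    (fun y hy ↦ Fintype.mem_piFinset.1 hy j)]
  refine Finset.sum_congr rfl fun a _ ↦ ?_
  rw [Finset.sum_mul]
  refine Finset.sum_congr rfl fun y hy ↦ ?_
  rw [(Finset.mem_filter.1 hy).2]

/-- The marginals of product weights are the factors. -/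
lemma sum_piFinset_prod_mul_apply {ι : Type*} [Fintype ι] [DecidableEq ι] (α : ι → Finset ℝ)
    (l : ι → ℝ → ℝ) (hl : ∀ i, ∑ a ∈ α i, l i a = 1) (g : ℝ → ℝ) (j : ι) :
    ∑ y ∈ Fintype.piFinset α, (∏ i, l i (y i)) * g (y j) = ∑ a ∈ α j, l j a * g a := by
  have h := Finset.prod_univ_sum α (fun i a ↦ l i a * if i = j then g a else 1)
  simp only [Finset.prod_mul_distrib, Finset.prod_ite_eq', Finset.mem_univ, if_true] at h
  rw [← h, Finset.prod_eq_single j]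
  · simp
  · intro i _ hij
    simp [hij, hl]
  · simp

/-- To bound a constant by a sum of infima, it suffices to bound it by every sum of values. -/
lemma ENNReal.le_sum_iInf {ι : Type*} [Fintype ι] {κ : ι → Type*} (f : ∀ i, κ i → ℝ≥0∞)
    (c : ℝ≥0∞) (h : ∀ k : ∀ i, κ i, c ≤ ∑ i, f i (k i)) : c ≤ ∑ i, ⨅ k, f i k := by
  by_cases hne : ∀ i, Nonempty (κ i)
  · have hseq (i : ι) : ∃ u : ℕ → κ i,
        Filter.Tendsto (fun n ↦ f i (u n)) Filter.atTop (nhds (⨅ k, f i k)) := by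
      obtain ⟨v, -, hv, hmem⟩ :=
        exists_seq_tendsto_sInf (Set.range_nonempty (f i)) (OrderBot.bddBelow _)
      choose u hu using hmem
      exact ⟨u, by simpa only [hu, ← sInf_range] using hv⟩
    choose u hu using hseq
    exact ge_of_tendsto' (tendsto_finsetSum _ fun i _ ↦ hu i) fun n ↦ h fun i ↦ u i n
  · push Not at hne
    obtain ⟨i, hi⟩ := hne
    have : ⨅ k, f i k = ⊤ := iInf_of_empty _
    rw [ENNReal.sum_eq_top.2 ⟨i, Finset.mem_univ i, this⟩]
    exact le_top

lemma PiLp.norm_rpow_eq_sum {ι : Type*} [Fintype ι] {p : ℝ} (hp : 1 ≤ p)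
    (x : PiLp (ENNReal.ofReal p) (fun _ : ι ↦ ℝ)) : ‖x‖ ^ p = ∑ i, ‖x i‖ ^ p := by
  have hp0 : 0 < p := by linarith
  have ht : (ENNReal.ofReal p).toReal = p := ENNReal.toReal_ofReal hp0.le
  rw [PiLp.norm_eq_sum (by rwa [ht]), ht, ← Real.rpow_mul (by positivity),
    one_div_mul_cancel hp0.ne', Real.rpow_one]

/-- **local product quantization.** Equip `ℝ^d` with the canonical `p`-norm.
For finite sets `α_1, …, α_d ⊂ ℝ` and `Γ = α_1 × … × α_d`, every `ξ ∈ ℝ^d` satisfies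
`F^p(ξ;Γ) = Σ_{j=1}^d F^p(ξ_j; α_j)`. -/
theorem stmt10 (d : ℕ) (p : ℝ) (hp : 1 ≤ p) [Fact (1 ≤ ENNReal.ofReal p)]
    (α : Fin d → Finset ℝ)
    (ξ : PiLp (ENNReal.ofReal p) (fun _ : Fin d => ℝ)) :
    dualQuantFpF p
      ((Fintype.piFinset α).map
        (WithLp.equiv (ENNReal.ofReal p) (∀ _ : Fin d, ℝ)).symm.toEmbedding) ξ
      = ∑ j, dualQuantFpF p (α j) (WithLp.equiv (ENNReal.ofReal p) (∀ _ : Fin d, ℝ) ξ j) := by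
  have hcost (L : (Fin d → ℝ) → ℝ) :
      ∑ y ∈ Fintype.piFinset α, L y * ‖ξ - WithLp.toLp (ENNReal.ofReal p) y‖ ^ p
        = ∑ j, ∑ y ∈ Fintype.piFinset α, L y * ‖ξ j - y j‖ ^ p := by
    rw [Finset.sum_comm]
    refine Finset.sum_congr rfl fun y _ ↦ ?_
    rw [PiLp.norm_rpow_eq_sum hp, Finset.mul_sum]
    rfl
  apply le_antisymm
  · refine ENNReal.le_sum_iInf _ _ fun l ↦ ?_
    have hmarg := sum_piFinset_prod_mul_apply α (fun j ↦ (l j).1) fun j ↦ (l j).2.2.1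
    rw [← ENNReal.ofReal_sum_of_nonneg fun j _ ↦ Finset.sum_nonneg fun a _ ↦
      mul_nonneg ((l j).2.1 a) (by positivity)]
    refine (dualQuantFpF_le p _ ξ (fun y ↦ ∏ i, (l i).1 (y i))
      (fun y ↦ Finset.prod_nonneg fun i _ ↦ (l i).2.1 _) ?_ ?_).trans_eq ?_
    · rw [Finset.sum_map]
      exact (Finset.prod_univ_sum α fun i ↦ (l i).1).symm.trans
        (Finset.prod_eq_one fun i _ ↦ (l i).2.2.1)
    · rw [Finset.sum_map]
      ext j
      rw [WithLp.ofLp_sum, Finset.sum_apply]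
      exact (hmarg id j).trans (l j).2.2.2
    · rw [Finset.sum_map]
      congr 1
      refine (hcost fun y ↦ ∏ i, (l i).1 (y i)).trans (Finset.sum_congr rfl fun j _ ↦ ?_)
      exact hmarg (fun a ↦ ‖ξ j - a‖ ^ p) j
  · refine le_iInf fun ⟨l, h0, h1, hξ⟩ ↦ ?_
    rw [Finset.sum_map] at h1 hξ ⊢
    have hmarg := sum_piFinset_mul_apply α fun y ↦ l (WithLp.toLp (ENNReal.ofReal p) y)
    refine le_of_le_of_eq (Finset.sum_le_sum fun j _ ↦ dualQuantFpF_le p (α j) _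
      (fun a ↦ ∑ y ∈ Fintype.piFinset α with y j = a, l (WithLp.toLp (ENNReal.ofReal p) y))
      (fun a ↦ Finset.sum_nonneg fun y _ ↦ h0 _) ?_ ?_) ?_
    · simpa using (hmarg (fun _ ↦ 1) j).trans (by simpa using h1)
    · refine (hmarg id j).trans ?_
      rw [← hξ, WithLp.equiv_apply, WithLp.ofLp_sum, Finset.sum_apply]
      rfl
    · rw [← ENNReal.ofReal_sum_of_nonneg fun j _ ↦ Finset.sum_nonneg fun a _ ↦
        mul_nonneg (Finset.sum_nonneg fun y _ ↦ h0 _) (by positivity)]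
      congr 1
      refine (Finset.sum_congr rfl fun j _ ↦ ?_).trans
        (hcost fun y ↦ l (WithLp.toLp (ENNReal.ofReal p) y)).symm
      exact hmarg (fun a ↦ ‖ξ j - a‖ ^ p) j
end

section
/- Let p ∈ [1,∞) and let X be a random vector in ℝ^d with compactly supported distribution and span(supp(P_X)) = ℝ^d. For every integer n ≥ d+1, the L^p-mean dual quantization error function γ ↦ d_{n,p}(X,γ) on (ℝ^d)^n is lower semicontinuous; moreover, if p > 1 it attains a minimum, i.e. there exists γ* ∈ (ℝ^d)^n with d_{n,p}(X,γ*) = d_{n,p}(X). -/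
open MeasureTheory Set
open scoped ENNReal

open Filter Topology in
/-- The local dual quantization error does not increase in the limit, even if for `1 < p` some of
the points of the tuple escape to infinity and are replaced by arbitrary points. -/
theorem dualQuantFp_le_liminf {E ι : Type*} [NormedAddCommGroup E] [NormedSpace ℝ E]
    {p : ℝ} (hp : 1 ≤ p) {n : ℕ} {f : Filter ι} {y : ι → Fin n → E} {x : Fin n → E}
    {η : ι → E} {ξ : E}
    (hy : ∀ i, Tendsto (fun k => y k i) f (𝓝 (x i)) ∨
      (1 < p ∧ Tendsto (fun k => ‖y k i‖) f atTop))
    (hη : Tendsto η f (𝓝 ξ)) :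
    dualQuantFp p x ξ ≤ liminf (fun k => dualQuantFp p (y k) (η k)) f := by
  have hp0 : 0 < p := by linarith
  by_contra! hlt
  obtain ⟨c, hc1, hc2⟩ := ENNReal.lt_iff_exists_real_btwn.1 hlt |>.imp fun _ h => h.2
  have hfreq := frequently_lt_of_liminf_lt (by isBoundedDefault) hc1
  have hne : NeBot (f ⊓ 𝓟 {k | dualQuantFp p (y k) (η k) < ENNReal.ofReal c}) :=
    frequently_mem_iff_neBot.1 hfreq
  set u : Ultrafilter ι := @Ultrafilter.of _ _ hne
  have hu : (u : Filter ι) ≤ f ⊓ 𝓟 {k | dualQuantFp p (y k) (η k) < ENNReal.ofReal c} :=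
    @Ultrafilter.of_le _ _ hne
  have huf : (u : Filter ι) ≤ f := hu.trans inf_le_left
  have hmem : ∀ᶠ k in (u : Filter ι), dualQuantFp p (y k) (η k) < ENNReal.ofReal c :=
    hu.trans inf_le_right (mem_principal_self _)
  have hex : ∀ k, ∃ l : Fin n → ℝ, dualQuantFp p (y k) (η k) < ENNReal.ofReal c →
      ((∀ i, 0 ≤ l i) ∧ ∑ i, l i = 1 ∧ ∑ i, l i • y k i = η k) ∧
        ∑ i, l i * ‖η k - y k i‖ ^ p < c := by
    intro k
    by_cases h : dualQuantFp p (y k) (η k) < ENNReal.ofReal c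
    · obtain ⟨l, hl⟩ := iInf_lt_iff.1 h
      exact ⟨l.1, fun _ => ⟨l.2, (ENNReal.ofReal_lt_ofReal_iff'.1 hl).1⟩⟩
    · exact ⟨0, fun h' => absurd h' h⟩
  choose l hl using hex
  have hl' := hmem.mono fun k hk => hl k hk
  obtain ⟨m, hm, hlm⟩ := (isCompact_stdSimplex ℝ (Fin n)).ultrafilter_le_nhds' (u.map l)
    (hl'.mono fun k hk => ⟨hk.1.1, hk.1.2.1⟩)
  have hlim : ∀ i, Tendsto (fun k => l k i) u (𝓝 (m i)) := tendsto_pi_nhds.1 hlm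
  have hη' : Tendsto η u (𝓝 ξ) := hη.mono_left huf
  have hterm : ∀ i k, (((∀ i, 0 ≤ l k i) ∧ ∑ i, l k i = 1 ∧ ∑ i, l k i • y k i = η k) ∧
      ∑ i, l k i * ‖η k - y k i‖ ^ p < c) → l k i * ‖η k - y k i‖ ^ p ≤ c := fun i k hk =>
    (Finset.single_le_sum (f := fun i => l k i * ‖η k - y k i‖ ^ p)
      (fun j _ => mul_nonneg (hk.1.1 j) (by positivity)) (Finset.mem_univ i)).trans hk.2.le
  have hcase : ∀ i, Tendsto (fun k => y k i) u (𝓝 (x i)) ∨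
      (m i = 0 ∧ Tendsto (fun k => l k i • (η k - y k i)) u (𝓝 0)) := by
    intro i
    rcases hy i with h | ⟨h1, h⟩
    · exact .inl (h.mono_left huf)
    · right
      have hD : Tendsto (fun k => ‖η k - y k i‖) u atTop := by
        refine tendsto_atTop_mono (fun k => ?_)
          (tendsto_atTop_add_right_of_le' _ (-(‖ξ‖ + 1)) (h.mono_left huf)
            (g := fun k => -‖η k‖) ?_)
        · have := norm_sub_norm_le (y k i) (η k)
          rw [norm_sub_rev] at this
          linarith
        · filter_upwards [hη'.norm.eventually_lt_const (lt_add_one ‖ξ‖)] with k hk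
          linarith
      have hz : ∀ q : ℝ, 0 < q → Tendsto (fun k => c * ‖η k - y k i‖ ^ (-q)) u (𝓝 0) :=
        fun q hq => by simpa using ((tendsto_rpow_neg_atTop hq).comp hD).const_mul c
      constructor
      · refine tendsto_nhds_unique (hlim i) (squeeze_zero' (hl'.mono fun k hk => hk.1.1 i) ?_
          (hz p hp0))
        filter_upwards [hl', hD.eventually_gt_atTop 0] with k hk hpos
        rw [Real.rpow_neg hpos.le, ← div_eq_mul_inv, le_div_iff₀ (by positivity)]
        exact hterm i k hk
      · refine squeeze_zero_norm' ?_ (hz (p - 1) (by linarith))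
        filter_upwards [hl', hD.eventually_gt_atTop 0] with k hk hpos
        rw [norm_smul, Real.norm_of_nonneg (hk.1.1 i), Real.rpow_neg hpos.le, ← div_eq_mul_inv,
          le_div_iff₀ (by positivity), mul_assoc, ← Real.rpow_one_add' hpos.le (by linarith)]
        simpa using hterm i k hk
  have hvec : Tendsto (fun k => ∑ i, l k i • (η k - y k i)) u (𝓝 (∑ i, m i • (ξ - x i))) := by
    refine tendsto_finsetSum _ fun i _ => ?_
    rcases hcase i with h | ⟨h0, h⟩
    · exact (hlim i).smul (hη'.sub h)
    · simpa [h0] using h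
  have hzero : ∑ i, m i • (ξ - x i) = 0 := by
    refine tendsto_nhds_unique hvec (tendsto_const_nhds.congr' ?_)
    filter_upwards [hl'] with k hk
    simp [smul_sub, Finset.sum_sub_distrib, ← Finset.sum_smul, hk.1.2.1, hk.1.2.2]
  have hbary : ∑ i, m i • x i = ξ := by
    simp only [smul_sub, Finset.sum_sub_distrib, ← Finset.sum_smul, hm.2, one_smul] at hzero
    exact (sub_eq_zero.1 hzero).symm
  have hcost : ∑ i, m i * ‖ξ - x i‖ ^ p ≤ c := by
    classical
    let a : Fin n → ι → ℝ := fun i k =>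
      if Tendsto (fun k => y k i) u (𝓝 (x i)) then l k i * ‖η k - y k i‖ ^ p else 0
    have ha : Tendsto (fun k => ∑ i, a i k) u (𝓝 (∑ i, m i * ‖ξ - x i‖ ^ p)) := by
      refine tendsto_finsetSum _ fun i _ => ?_
      by_cases h : Tendsto (fun k => y k i) u (𝓝 (x i))
      · simp only [a, if_pos h]
        exact (hlim i).mul ((hη'.sub h).norm.rpow_const (.inr hp0.le))
      · simp [a, if_neg h, ((hcase i).resolve_left h).1]
    refine le_of_tendsto ha ?_
    filter_upwards [hl'] with k hk
    refine le_trans (Finset.sum_le_sum fun i _ => ?_) hk.2.le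
    have : 0 ≤ l k i * ‖η k - y k i‖ ^ p := mul_nonneg (hk.1.1 i) (by positivity)
    dsimp only [a]
    split_ifs
    exacts [le_rfl, this]
  exact hc2.not_ge ((iInf_le _ ⟨m, hm.1, hm.2, hbary⟩).trans (ENNReal.ofReal_le_ofReal hcost))

theorem measurable_dualQuantFp {E : Type*} [NormedAddCommGroup E] [NormedSpace ℝ E]
    [MeasurableSpace E] [BorelSpace E] {p : ℝ} (hp : 1 ≤ p) {n : ℕ} (x : Fin n → E) :
    Measurable (dualQuantFp p x) :=
  LowerSemicontinuous.measurable fun _ => lowerSemicontinuousAt_iff_le_liminf.2 <|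
    dualQuantFp_le_liminf hp (fun _ => .inl tendsto_const_nhds) Filter.tendsto_id

open Filter Topology in
theorem lintegral_dualQuantFp_le_liminf {E : Type*} [NormedAddCommGroup E] [NormedSpace ℝ E]
    [MeasurableSpace E] [BorelSpace E] (ν : Measure E) {p : ℝ} (hp : 1 ≤ p) {n : ℕ}
    {y : ℕ → Fin n → E} {x : Fin n → E}
    (hy : ∀ i, Tendsto (fun k => y k i) atTop (𝓝 (x i)) ∨
      (1 < p ∧ Tendsto (fun k => ‖y k i‖) atTop atTop)) :
    ∫⁻ ξ, dualQuantFp p x ξ ∂ν ≤ liminf (fun k => ∫⁻ ξ, dualQuantFp p (y k) ξ ∂ν) atTop :=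
  (lintegral_mono fun _ => dualQuantFp_le_liminf hp hy tendsto_const_nhds).trans
    (lintegral_liminf_le fun k => measurable_dualQuantFp hp (y k))

open Filter Topology in
theorem lowerSemicontinuous_lintegral_dualQuantFp {E : Type*} [NormedAddCommGroup E]
    [NormedSpace ℝ E] [MeasurableSpace E] [BorelSpace E] (ν : Measure E) {p : ℝ} (hp : 1 ≤ p)
    {n : ℕ} : LowerSemicontinuous fun γ : Fin n → E => ∫⁻ ξ, dualQuantFp p γ ξ ∂ν := by
  intro γ c hc
  by_contra h
  obtain ⟨y, hy, hyc⟩ := exists_seq_forall_of_frequently (not_eventually.1 h)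
  have := lintegral_dualQuantFp_le_liminf ν hp fun i => .inl (tendsto_pi_nhds.1 hy i)
  exact (hc.trans_le this).not_ge
    (liminf_le_of_frequently_le' (.of_forall fun k => not_lt.1 (hyc k)))

open Filter Topology in
/-- Along a subsequence, every component of a sequence of tuples converges or escapes to
infinity. -/
theorem exists_subseq_tendsto_or_norm_atTop {E ι : Type*} [NormedAddCommGroup E] [ProperSpace E]
    [Finite ι] (y : ℕ → ι → E) :
    ∃ φ : ℕ → ℕ, StrictMono φ ∧ ∃ x : ι → E, ∀ i,
      Tendsto (fun k => y (φ k) i) atTop (𝓝 (x i)) ∨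
        Tendsto (fun k => ‖y (φ k) i‖) atTop atTop := by
  suffices ∀ s : Set ι, s.Finite → ∃ φ : ℕ → ℕ, StrictMono φ ∧ ∀ i ∈ s, ∃ a,
      Tendsto (fun k => y (φ k) i) atTop (𝓝 a) ∨
        Tendsto (fun k => ‖y (φ k) i‖) atTop atTop by
    obtain ⟨φ, hφ, h⟩ := this univ finite_univ
    choose x hx using fun i => h i (mem_univ i)
    exact ⟨φ, hφ, x, hx⟩
  intro s hs
  induction s, hs using Set.Finite.induction_on with
  | empty => exact ⟨id, strictMono_id, by simp⟩
  | @insert i s _ _ ih =>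
    obtain ⟨φ, hφ, h⟩ := ih
    by_cases hi : Tendsto (fun k => ‖y (φ k) i‖) atTop atTop
    · exact ⟨φ, hφ, forall_mem_insert.2 ⟨⟨0, .inr hi⟩, h⟩⟩
    · simp only [tendsto_atTop, not_forall, not_eventually, not_le] at hi
      obtain ⟨R, hR⟩ := hi
      obtain ⟨a, -, ψ, hψ, ha⟩ := tendsto_subseq_of_frequently_bounded
        (Metric.isBounded_ball (x := (0 : E)) (r := R)) (x := fun k => y (φ k) i)
        (hR.mono fun k hk => mem_ball_zero_iff.2 hk)
      refine ⟨φ ∘ ψ, hφ.comp hψ, forall_mem_insert.2 ⟨⟨a, .inl ha⟩, fun j hj => ?_⟩⟩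
      obtain ⟨b, hb⟩ := h j hj
      exact ⟨b, hb.imp (fun h => h.comp hψ.tendsto_atTop) fun h => h.comp hψ.tendsto_atTop⟩

open Filter Topology in
theorem exists_forall_lintegral_dualQuantFp_le {E : Type*} [NormedAddCommGroup E]
    [NormedSpace ℝ E] [ProperSpace E] [MeasurableSpace E] [BorelSpace E] (ν : Measure E) {p : ℝ}
    (hp : 1 < p) (n : ℕ) : ∃ γ₀ : Fin n → E, ∀ γ : Fin n → E,
      ∫⁻ ξ, dualQuantFp p γ₀ ξ ∂ν ≤ ∫⁻ ξ, dualQuantFp p γ ξ ∂ν := by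
  obtain ⟨v, -, hv, hmem⟩ := exists_seq_tendsto_sInf
    (range_nonempty fun γ : Fin n → E => ∫⁻ ξ, dualQuantFp p γ ξ ∂ν) (OrderBot.bddBelow _)
  choose y hy using hmem
  obtain ⟨φ, hφ, x, hx⟩ := exists_subseq_tendsto_or_norm_atTop y
  refine ⟨x, fun γ => ?_⟩
  refine (lintegral_dualQuantFp_le_liminf ν hp.le fun i => (hx i).imp_right (.intro hp)).trans ?_
  simp only [hy]
  exact (hv.comp hφ.tendsto_atTop).liminf_eq.trans_le (sInf_le (mem_range_self γ))

/-- For `p ∈ [1,∞)`, a compactly supported random vector `X` in `ℝ^d` with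
`span(supp P_X) = ℝ^d` and `n ≥ d+1`, the error function
`γ ↦ d_{n,p}(X,γ) = (E F_{n,p}(X,γ)^p)^{1/p}` on `(ℝ^d)^n` is lower semicontinuous, and if
`p > 1` it attains a minimum. -/
theorem stmt14 {E : Type*} [NormedAddCommGroup E] [NormedSpace ℝ E]
    [FiniteDimensional ℝ E] [MeasurableSpace E] [BorelSpace E]
    {Ω : Type*} [MeasurableSpace Ω] {μ : Measure Ω} [IsProbabilityMeasure μ]
    (X : Ω → E) (hX : Measurable X)
    (hcomp : IsCompact (measSupport (μ.map X)))
    (hspan : Submodule.span ℝ (measSupport (μ.map X)) = ⊤)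
    (p : ℝ) (hp : 1 ≤ p) (n : ℕ) (hn : Module.finrank ℝ E + 1 ≤ n) :
    LowerSemicontinuous
      (fun γ : Fin n → E => (∫⁻ ξ, dualQuantFp p γ ξ ∂(μ.map X)) ^ (1 / p)) ∧
    (1 < p → ∃ γ₀ : Fin n → E,
      (∫⁻ ξ, dualQuantFp p γ₀ ξ ∂(μ.map X)) ^ (1 / p) =
        ⨅ γ : Fin n → E, (∫⁻ ξ, dualQuantFp p γ ξ ∂(μ.map X)) ^ (1 / p)) := by
  have hmono : Monotone fun t : ℝ≥0∞ => t ^ (1 / p) :=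
    ENNReal.monotone_rpow_of_nonneg (by positivity)
  refine ⟨ENNReal.continuous_rpow_const.comp_lowerSemicontinuous
    (lowerSemicontinuous_lintegral_dualQuantFp _ hp) hmono, fun hp1 => ?_⟩
  have : ProperSpace E := FiniteDimensional.proper ℝ E
  obtain ⟨γ₀, h⟩ := exists_forall_lintegral_dualQuantFp_le (μ.map X) hp1 n
  exact ⟨γ₀, le_antisymm (le_iInf fun γ => hmono (h γ)) (iInf_le _ γ₀)⟩
end
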